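/- arXiv:1006.5626 — 4 statements merged into one kernel-verified Lean document; each statement's English description precedes it below -/
import Mathlib

section
/- Suppose that the subspaces M^n(t) = {y ∈ ℝ^m : M₁(t)y = y} and M^{m−n}(t) = {y ∈ ℝ^m : M₁(t)y = 0}, taken together, are invariant for y′ = Q(t)y, i.e. for every y₀ with M₁(0)y₀ = y₀ one has M₁(t)(Y(t)y₀) = Y(t)y₀ for all t, and for every y₀ with M₁(0)y₀ = 0 one has M₁(t)(Y(t)y₀) = 0 for all t. Define P(t) = (Φ₁′(t) + Φ₁(t)Q(t))Φ₁⁺(t) and G(t) = (Φ₂′(t) + Φ₂(t)Q(t))Φ₂⁺(t), and let X : ℝ → M_n(ℝ) and Z : ℝ → M_p(ℝ) be the fundamental matrices of x′ = P(t)x and z′ = G(t)z (X′ = PX, X(0) = E; Z′ = GZ, Z(0) = E). Then the change of variables y = Φ₁⁺(t)x + Φ₂⁺(t)z reduces y′ = Q(t)y to this pair of equations; concretely, Y(t) = Φ₁⁺(t)X(t)Φ₁(0) + Φ₂⁺(t)Z(t)Φ₂(0) for all t ∈ ℝ. -/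
open Matrix

/-- Entrywise derivative of a matrix-valued function of a real variable. -/
def MHasDerivAt {k l : Type*} (A : ℝ → Matrix k l ℝ) (A' : Matrix k l ℝ) (t : ℝ) : Prop :=
  ∀ i j, HasDerivAt (fun s => A s i j) (A' i j) t



theorem mhd_mul {k l r : Type*} [Fintype l] {A : ℝ → Matrix k l ℝ} {B : ℝ → Matrix l r ℝ}
    {A' : Matrix k l ℝ} {B' : Matrix l r ℝ} {t : ℝ}
    (hA : MHasDerivAt A A' t) (hB : MHasDerivAt B B' t) :
    MHasDerivAt (fun s => A s * B s) (A' * B t + A t * B') t := by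
  intro i j
  simp only [Matrix.mul_apply, Matrix.add_apply, ← Finset.sum_add_distrib]
  exact HasDerivAt.fun_sum fun x _ => (hA i x).mul (hB x j)

theorem mhd_const {k l : Type*} (C : Matrix k l ℝ) (t : ℝ) :
    MHasDerivAt (fun _ => C) 0 t := fun i j => hasDerivAt_const t (C i j)

theorem mhd_cont {k l : Type*} {A A' : ℝ → Matrix k l ℝ}
    (hA : ∀ t, MHasDerivAt A (A' t) t) : Continuous A :=
  continuous_matrix fun i j => continuous_iff_continuousAt.2 fun t => (hA t i j).continuousAt

theorem mhd_unique {k : Type*} [Fintype k] {A U V : ℝ → Matrix k k ℝ} (hA : Continuous A)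
    (hU : ∀ t, MHasDerivAt U (A t * U t) t) (hV : ∀ t, MHasDerivAt V (A t * V t) t)
    (h0 : U 0 = V 0) (t : ℝ) : U t = V t := by
  have hc : Continuous fun t => ∑ i, ∑ j, |A t i j| := by
    refine continuous_finsetSum _ fun i _ => continuous_finsetSum _ fun j _ => ?_
    exact (hA.matrix_elem i j).abs
  obtain ⟨K, hK⟩ := (isCompact_Icc (a := -(|t| + 1)) (b := |t| + 1)).bddAbove_image hc.continuousOn
  have hK' : ∀ s ∈ Set.Icc (-(|t| + 1)) (|t| + 1), ∑ i, ∑ j, |A s i j| ≤ K :=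
    fun s hs => hK (Set.mem_image_of_mem _ hs)
  ext i j
  have key := ODE_solution_unique_of_mem_Ioo (K := K.toNNReal) (v := fun s x => A s *ᵥ x)
    (s := fun _ => Set.univ) (a := -(|t| + 1)) (b := |t| + 1) (t₀ := 0)
    (f := fun s i => U s i j) (g := fun s i => V s i j) ?_ ?_ ?_ ?_ ?_
  · have ht : t ∈ Set.Ioo (-(|t| + 1)) (|t| + 1) :=
      ⟨by linarith [neg_abs_le t], by linarith [le_abs_self t]⟩
    exact congrFun (key ht) i
  · intro s hs
    refine LipschitzOnWith.of_dist_le_mul fun x _ y _ => ?_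
    rw [dist_eq_norm, dist_eq_norm, ← Matrix.mulVec_sub]
    have hs' := hK' s (Set.Ioo_subset_Icc_self hs)
    refine (pi_norm_le_iff_of_nonneg (by positivity)).2 fun a => ?_
    have h1 : ‖(A s *ᵥ (x - y)) a‖ ≤ (∑ b, |A s a b|) * ‖x - y‖ := by
      rw [Finset.sum_mul]
      refine (norm_sum_le _ _).trans (Finset.sum_le_sum fun b _ => ?_)
      rw [norm_mul, Real.norm_eq_abs]
      gcongr
      exact norm_le_pi_norm (x - y) b
    refine h1.trans ?_
    gcongr
    refine le_trans ?_ (Real.le_coe_toNNReal K)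
    refine le_trans ?_ hs'
    exact Finset.single_le_sum (f := fun a => ∑ b, |A s a b|)
      (fun _ _ => Finset.sum_nonneg fun _ _ => abs_nonneg _) (Finset.mem_univ a)
  · constructor <;> linarith [abs_nonneg t]
  · exact fun s _ => ⟨hasDerivAt_pi.2 fun a => hU s a j, trivial⟩
  · exact fun s _ => ⟨hasDerivAt_pi.2 fun a => hV s a j, trivial⟩
  · simp only [h0]

theorem block_unique {k l : Type*} [Fintype k] [DecidableEq k] [Fintype l] [DecidableEq l]
    {F F' : ℝ → Matrix k l ℝ} {Fp Fp' : ℝ → Matrix l k ℝ} {Q Y : ℝ → Matrix l l ℝ}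
    {P X : ℝ → Matrix k k ℝ}
    (hF : ∀ t, MHasDerivAt F (F' t) t) (hFc : Continuous F')
    (hFp : ∀ t, MHasDerivAt Fp (Fp' t) t) (hQ : Continuous Q)
    (hid : ∀ t, F t * Fp t = 1)
    (hY : ∀ t, MHasDerivAt Y (Q t * Y t) t) (hY0 : Y 0 = 1)
    (hP : ∀ t, P t = (F' t + F t * Q t) * Fp t)
    (hX : ∀ t, MHasDerivAt X (P t * X t) t) (hX0 : X 0 = 1)
    (hinv : ∀ t, Fp t * (F t * (Y t * Fp 0)) = Y t * Fp 0) (t : ℝ) :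
    Y t * Fp 0 = Fp t * X t := by
  have hPc : Continuous P := by
    rw [funext hP]
    exact (hFc.add ((mhd_cont hF).matrix_mul hQ)).matrix_mul (mhd_cont hFp)
  have := mhd_unique (U := fun t => F t * (Y t * Fp 0)) hPc ?_ hX (by simp [hY0, hX0, hid]) t
  · rw [← this, hinv]
  · intro t
    have h := mhd_mul (hF t) (mhd_mul (hY t) (mhd_const (Fp 0) t))
    convert h using 1
    rw [hP, Matrix.mul_assoc, hinv, Matrix.mul_zero, add_zero, Matrix.add_mul]
    simp only [Matrix.mul_assoc]

/-- If the subspaces `M^n(t)` and `M^{m-n}(t)`, taken together, are invariant manifolds of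
`y' = Q(t)y`, then the change of variables `y = Φ₁⁺(t)x + Φ₂⁺(t)z` reduces this equation to
the pair `x' = P(t)x`, `z' = G(t)z`; concretely
`Y(t) = Φ₁⁺(t) X(t) Φ₁(0) + Φ₂⁺(t) Z(t) Φ₂(0)` for all `t`. -/
theorem invariant_manifolds_give_decomposition
    (m n : ℕ) (hn : 0 < n) (hnm : n < m)
    (Φ₁ : ℝ → Matrix (Fin n) (Fin m) ℝ) (Φ₂ : ℝ → Matrix (Fin (m - n)) (Fin m) ℝ)
    (Φ₁p : ℝ → Matrix (Fin m) (Fin n) ℝ) (Φ₂p : ℝ → Matrix (Fin m) (Fin (m - n)) ℝ)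
    (Φ₁' : ℝ → Matrix (Fin n) (Fin m) ℝ) (Φ₂' : ℝ → Matrix (Fin (m - n)) (Fin m) ℝ)
    (Φ₁p' : ℝ → Matrix (Fin m) (Fin n) ℝ) (Φ₂p' : ℝ → Matrix (Fin m) (Fin (m - n)) ℝ)
    (hΦ₁ : ∀ t, MHasDerivAt Φ₁ (Φ₁' t) t) (hΦ₁c : Continuous Φ₁')
    (hΦ₂ : ∀ t, MHasDerivAt Φ₂ (Φ₂' t) t) (hΦ₂c : Continuous Φ₂')
    (hΦ₁p : ∀ t, MHasDerivAt Φ₁p (Φ₁p' t) t) (hΦ₁pc : Continuous Φ₁p')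
    (hΦ₂p : ∀ t, MHasDerivAt Φ₂p (Φ₂p' t) t) (hΦ₂pc : Continuous Φ₂p')
    -- block relations coming from `Φ(t)⁻¹ Φ(t) = Φ(t) Φ(t)⁻¹ = E`
    (hid1 : ∀ t, Φ₁ t * Φ₁p t = 1)
    (hid2 : ∀ t, Φ₂ t * Φ₂p t = 1)
    (hid3 : ∀ t, Φ₁ t * Φ₂p t = 0)
    (hid4 : ∀ t, Φ₂ t * Φ₁p t = 0)
    (hid5 : ∀ t, Φ₁p t * Φ₁ t + Φ₂p t * Φ₂ t = 1)
    (Q : ℝ → Matrix (Fin m) (Fin m) ℝ) (hQ : Continuous Q)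
    (Y : ℝ → Matrix (Fin m) (Fin m) ℝ)
    (hY : ∀ t, MHasDerivAt Y (Q t * Y t) t) (hY0 : Y 0 = 1)
    (M₁ : ℝ → Matrix (Fin m) (Fin m) ℝ) (hM₁ : ∀ t, M₁ t = Φ₁p t * Φ₁ t)
    -- invariance of `M^n(t)`
    (hinv1 : ∀ y₀ : Fin m → ℝ, M₁ 0 *ᵥ y₀ = y₀ →
      ∀ t, M₁ t *ᵥ (Y t *ᵥ y₀) = Y t *ᵥ y₀)
    -- invariance of `M^{m-n}(t)`
    (hinv2 : ∀ y₀ : Fin m → ℝ, M₁ 0 *ᵥ y₀ = 0 →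
      ∀ t, M₁ t *ᵥ (Y t *ᵥ y₀) = 0)
    (P : ℝ → Matrix (Fin n) (Fin n) ℝ)
    (hP : ∀ t, P t = (Φ₁' t + Φ₁ t * Q t) * Φ₁p t)
    (G : ℝ → Matrix (Fin (m - n)) (Fin (m - n)) ℝ)
    (hG : ∀ t, G t = (Φ₂' t + Φ₂ t * Q t) * Φ₂p t)
    (X : ℝ → Matrix (Fin n) (Fin n) ℝ)
    (hX : ∀ t, MHasDerivAt X (P t * X t) t) (hX0 : X 0 = 1)
    (Z : ℝ → Matrix (Fin (m - n)) (Fin (m - n)) ℝ)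
    (hZ : ∀ t, MHasDerivAt Z (G t * Z t) t) (hZ0 : Z 0 = 1) :
    ∀ t : ℝ, Y t = Φ₁p t * X t * Φ₁ 0 + Φ₂p t * Z t * Φ₂ 0 := by
  have e1 : ∀ t, Φ₁p t * (Φ₁ t * (Y t * Φ₁p 0)) = Y t * Φ₁p 0 := by
    intro t
    have h : ∀ w, M₁ t *ᵥ (Y t *ᵥ (Φ₁p 0 *ᵥ w)) = Y t *ᵥ (Φ₁p 0 *ᵥ w) := fun w =>
      hinv1 _ (by rw [hM₁, Matrix.mulVec_mulVec, Matrix.mul_assoc, hid1, Matrix.mul_one]) t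
    refine Matrix.ext_of_mulVec_single fun j => ?_
    have := h (Pi.single j 1)
    simpa only [hM₁, Matrix.mulVec_mulVec, Matrix.mul_assoc] using this
  have e2 : ∀ t, Φ₂p t * (Φ₂ t * (Y t * Φ₂p 0)) = Y t * Φ₂p 0 := by
    intro t
    have h : ∀ w, M₁ t *ᵥ (Y t *ᵥ (Φ₂p 0 *ᵥ w)) = 0 := fun w =>
      hinv2 _ (by rw [hM₁, Matrix.mulVec_mulVec, Matrix.mul_assoc, hid3, Matrix.mul_zero,
        Matrix.zero_mulVec]) t
    have h2 : Φ₁p t * Φ₁ t * (Y t * Φ₂p 0) = 0 := by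
      refine Matrix.ext_of_mulVec_single fun j => ?_
      have := h (Pi.single j 1)
      rw [Matrix.zero_mulVec]
      simpa only [hM₁, Matrix.mulVec_mulVec, Matrix.mul_assoc] using this
    have h3 := congrArg (· * (Y t * Φ₂p 0)) (hid5 t)
    simpa only [Matrix.add_mul, h2, zero_add, Matrix.one_mul, Matrix.mul_assoc (Φ₂p t)] using h3
  intro t
  have f1 := block_unique hΦ₁ hΦ₁c hΦ₁p hQ hid1 hY hY0 hP hX hX0 e1 t
  have f2 := block_unique hΦ₂ hΦ₂c hΦ₂p hQ hid2 hY hY0 hG hZ hZ0 e2 t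
  rw [← f1, ← f2, Matrix.mul_assoc, Matrix.mul_assoc, ← Matrix.mul_add, hid5, Matrix.mul_one]
end

section
/- Suppose there exist continuous matrix functions P : ℝ → M_n(ℝ) and G : ℝ → M_p(ℝ) with fundamental matrices X and Z (X′ = PX, X(0) = E; Z′ = GZ, Z(0) = E) such that the change of variables y = Φ₁⁺(t)x + Φ₂⁺(t)z reduces y′ = Q(t)y to the pair x′ = P(t)x, z′ = G(t)z; concretely, Y(t) = Φ₁⁺(t)X(t)Φ₁(0) + Φ₂⁺(t)Z(t)Φ₂(0) for all t ∈ ℝ. Then: (a) for every y₀ with M₁(0)y₀ = y₀ one has M₁(t)(Y(t)y₀) = Y(t)y₀ for all t; (b) for every y₀ with M₁(0)y₀ = 0 one has M₁(t)(Y(t)y₀) = 0 for all t; and (c) P(t) = (Φ₁′(t) + Φ₁(t)Q(t))Φ₁⁺(t) and G(t) = (Φ₂′(t) + Φ₂(t)Q(t))Φ₂⁺(t) for all t ∈ ℝ. -/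
open Matrix

theorem MHasDerivAt.mul' {a b c : Type*} [Fintype b] {A : ℝ → Matrix a b ℝ} {B : ℝ → Matrix b c ℝ}
    {A' : Matrix a b ℝ} {B' : Matrix b c ℝ} {t : ℝ} (hA : MHasDerivAt A A' t)
    (hB : MHasDerivAt B B' t) : MHasDerivAt (fun s => A s * B s) (A' * B t + A t * B') t := by
  intro i j
  simp only [Matrix.mul_apply, Matrix.add_apply, ← Finset.sum_add_distrib]
  exact HasDerivAt.fun_sum fun k _ => (hA i k).mul (hB k j)

theorem MHasDerivAt.mulConst {a b c : Type*} [Fintype b] {A : ℝ → Matrix a b ℝ}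
    {A' : Matrix a b ℝ} {t : ℝ} (hA : MHasDerivAt A A' t) (B : Matrix b c ℝ) :
    MHasDerivAt (fun s => A s * B) (A' * B) t := by
  intro i j
  simp only [Matrix.mul_apply]
  exact HasDerivAt.fun_sum fun k _ => (hA i k).mul_const (B k j)

theorem MHasDerivAt.uniq {a b : Type*} {A : ℝ → Matrix a b ℝ}
    {A' B' : Matrix a b ℝ} {t : ℝ} (hA : MHasDerivAt A A' t) (hB : MHasDerivAt A B' t) :
    A' = B' := by
  ext i j
  exact (hA i j).unique (hB i j)

theorem fund_isUnit {k : ℕ} (P X : ℝ → Matrix (Fin k) (Fin k) ℝ) (hP : Continuous P)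
    (hX : ∀ t, MHasDerivAt X (P t * X t) t) (hX0 : X 0 = 1) (t₀ : ℝ) : IsUnit (X t₀) := by
  rw [Matrix.isUnit_iff_isUnit_det, isUnit_iff_ne_zero]
  intro hdet
  obtain ⟨v, hv, hXv⟩ := Matrix.exists_mulVec_eq_zero_iff.mpr hdet
  apply hv
  set c : ℝ → ℝ := fun s => ∑ i, ∑ j, |P s i j| with hc
  have hcc : Continuous c := by
    refine continuous_finsetSum _ fun i _ => continuous_finsetSum _ fun j _ => ?_
    exact (hP.matrix_elem i j).abs
  set R : ℝ := |t₀| + 1 with hR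
  obtain ⟨K, hK⟩ := (isCompact_Icc (a := -R) (b := R)).bddAbove_image hcc.continuousOn
  have hbd : ∀ s (w : Fin k → ℝ), ‖P s *ᵥ w‖ ≤ c s * ‖w‖ := by
    intro s w
    have hc0 : 0 ≤ c s := Finset.sum_nonneg fun i _ => Finset.sum_nonneg fun j _ => abs_nonneg _
    rw [pi_norm_le_iff_of_nonneg (mul_nonneg hc0 (norm_nonneg _))]
    intro i
    calc ‖(P s *ᵥ w) i‖ ≤ ∑ j, ‖P s i j * w j‖ :=
          norm_sum_le Finset.univ (fun j => P s i j * w j)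
      _ ≤ ∑ j, |P s i j| * ‖w‖ := by
          refine Finset.sum_le_sum fun j _ => ?_
          rw [norm_mul, Real.norm_eq_abs (P s i j)]
          exact mul_le_mul_of_nonneg_left (norm_le_pi_norm w j) (abs_nonneg _)
      _ = (∑ j, |P s i j|) * ‖w‖ := by rw [Finset.sum_mul]
      _ ≤ c s * ‖w‖ := by
          refine mul_le_mul_of_nonneg_right ?_ (norm_nonneg _)
          exact Finset.single_le_sum (f := fun i => ∑ j, |P s i j|)
            (fun i _ => Finset.sum_nonneg fun j _ => abs_nonneg _) (Finset.mem_univ i)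
  have hlip : ∀ s ∈ Set.Ioo (-R) R,
      LipschitzOnWith K.toNNReal (fun w : Fin k → ℝ => P s *ᵥ w) Set.univ := by
    intro s hs
    refine LipschitzWith.lipschitzOnWith (LipschitzWith.of_dist_le_mul fun x y => ?_)
    rw [dist_eq_norm, dist_eq_norm, ← Matrix.mulVec_sub]
    refine (hbd s _).trans (mul_le_mul_of_nonneg_right ?_ (norm_nonneg _))
    exact (hK ⟨s, Set.Ioo_subset_Icc_self hs, rfl⟩).trans (Real.le_coe_toNNReal K)
  have hder : ∀ s, HasDerivAt (fun s => X s *ᵥ v) (P s *ᵥ (X s *ᵥ v)) s := by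
    intro s
    rw [hasDerivAt_pi]
    intro i
    rw [Matrix.mulVec_mulVec]
    simp only [Matrix.mulVec, dotProduct]
    exact HasDerivAt.fun_sum fun j _ => (hX s i j).mul_const (v j)
  have ht₀ : t₀ ∈ Set.Ioo (-R) R := by
    constructor
    · have := neg_abs_le t₀; linarith
    · have := le_abs_self t₀; linarith
  have h0 : (0 : ℝ) ∈ Set.Ioo (-R) R := by
    have := abs_nonneg t₀
    constructor <;> linarith
  have key := ODE_solution_unique_of_mem_Ioo (v := fun s (w : Fin k → ℝ) => P s *ᵥ w)
    (s := fun _ => Set.univ) (f := fun s => X s *ᵥ v) (g := fun _ => 0) hlip ht₀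
    (fun s _ => ⟨hder s, Set.mem_univ _⟩)
    (fun s _ => ⟨by simpa using hasDerivAt_const s (0 : Fin k → ℝ), Set.mem_univ _⟩)
    (by simpa using hXv)
  simpa [hX0] using key h0

theorem block_formula {m k : ℕ} (F F' : ℝ → Matrix (Fin k) (Fin m) ℝ)
    (Fp : ℝ → Matrix (Fin m) (Fin k) ℝ) (Q Y : ℝ → Matrix (Fin m) (Fin m) ℝ)
    (P X : ℝ → Matrix (Fin k) (Fin k) ℝ)
    (hF : ∀ t, MHasDerivAt F (F' t) t) (hid : ∀ t, F t * Fp t = 1)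
    (hQ : Continuous Q) (hY : ∀ t, MHasDerivAt Y (Q t * Y t) t) (hY0 : Y 0 = 1)
    (hX : ∀ t, MHasDerivAt X (P t * X t) t)
    (hFY : ∀ t, F t * Y t = X t * F 0) (t : ℝ) :
    P t = (F' t + F t * Q t) * Fp t := by
  have h1 := (hF t).mul' (hY t)
  have h2 := (hX t).mulConst (F 0)
  rw [funext hFY] at h1
  have h3 := h1.uniq h2
  rw [Matrix.mul_assoc, ← hFY, ← Matrix.mul_assoc, ← Matrix.mul_assoc, ← Matrix.add_mul] at h3
  have hu := (Matrix.isUnit_iff_isUnit_det _).mp (fund_isUnit Q Y hQ hY hY0 t)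
  have h4 : F' t + F t * Q t = P t * F t := by
    have := congrArg (· * (Y t)⁻¹) h3
    simpa [Matrix.mul_assoc, Matrix.mul_nonsing_inv _ hu] using this
  rw [h4, Matrix.mul_assoc, hid, Matrix.mul_one]

/-- If `y' = Q(t)y` can be reduced by the change of variables `y = Φ₁⁺(t)x + Φ₂⁺(t)z` to the
pair `x' = P(t)x`, `z' = G(t)z` (concretely `Y(t) = Φ₁⁺(t)X(t)Φ₁(0) + Φ₂⁺(t)Z(t)Φ₂(0)`),
then the subspaces `M^n(t)` and `M^{m-n}(t)` are invariant manifolds of `y' = Q(t)y`, and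
`P(t) = (Φ₁' + Φ₁Q)Φ₁⁺`, `G(t) = (Φ₂' + Φ₂Q)Φ₂⁺`. -/
theorem decomposition_gives_invariant_manifolds
    (m n : ℕ) (hn : 0 < n) (hnm : n < m)
    (Φ₁ : ℝ → Matrix (Fin n) (Fin m) ℝ) (Φ₂ : ℝ → Matrix (Fin (m - n)) (Fin m) ℝ)
    (Φ₁p : ℝ → Matrix (Fin m) (Fin n) ℝ) (Φ₂p : ℝ → Matrix (Fin m) (Fin (m - n)) ℝ)
    (Φ₁' : ℝ → Matrix (Fin n) (Fin m) ℝ) (Φ₂' : ℝ → Matrix (Fin (m - n)) (Fin m) ℝ)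
    (Φ₁p' : ℝ → Matrix (Fin m) (Fin n) ℝ) (Φ₂p' : ℝ → Matrix (Fin m) (Fin (m - n)) ℝ)
    (hΦ₁ : ∀ t, MHasDerivAt Φ₁ (Φ₁' t) t) (hΦ₁c : Continuous Φ₁')
    (hΦ₂ : ∀ t, MHasDerivAt Φ₂ (Φ₂' t) t) (hΦ₂c : Continuous Φ₂')
    (hΦ₁p : ∀ t, MHasDerivAt Φ₁p (Φ₁p' t) t) (hΦ₁pc : Continuous Φ₁p')
    (hΦ₂p : ∀ t, MHasDerivAt Φ₂p (Φ₂p' t) t) (hΦ₂pc : Continuous Φ₂p')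
    -- block relations coming from `Φ(t)⁻¹ Φ(t) = Φ(t) Φ(t)⁻¹ = E`
    (hid1 : ∀ t, Φ₁ t * Φ₁p t = 1)
    (hid2 : ∀ t, Φ₂ t * Φ₂p t = 1)
    (hid3 : ∀ t, Φ₁ t * Φ₂p t = 0)
    (hid4 : ∀ t, Φ₂ t * Φ₁p t = 0)
    (hid5 : ∀ t, Φ₁p t * Φ₁ t + Φ₂p t * Φ₂ t = 1)
    (Q : ℝ → Matrix (Fin m) (Fin m) ℝ) (hQ : Continuous Q)
    (Y : ℝ → Matrix (Fin m) (Fin m) ℝ)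
    (hY : ∀ t, MHasDerivAt Y (Q t * Y t) t) (hY0 : Y 0 = 1)
    (M₁ : ℝ → Matrix (Fin m) (Fin m) ℝ) (hM₁ : ∀ t, M₁ t = Φ₁p t * Φ₁ t)
    (P : ℝ → Matrix (Fin n) (Fin n) ℝ) (hPc : Continuous P)
    (G : ℝ → Matrix (Fin (m - n)) (Fin (m - n)) ℝ) (hGc : Continuous G)
    (X : ℝ → Matrix (Fin n) (Fin n) ℝ)
    (hX : ∀ t, MHasDerivAt X (P t * X t) t) (hX0 : X 0 = 1)
    (Z : ℝ → Matrix (Fin (m - n)) (Fin (m - n)) ℝ)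
    (hZ : ∀ t, MHasDerivAt Z (G t * Z t) t) (hZ0 : Z 0 = 1)
    -- the change of variables `y = Φ₁⁺(t)x + Φ₂⁺(t)z` reduces (I) to the pair (III)
    (hred : ∀ t : ℝ, Y t = Φ₁p t * X t * Φ₁ 0 + Φ₂p t * Z t * Φ₂ 0) :
    (∀ y₀ : Fin m → ℝ, M₁ 0 *ᵥ y₀ = y₀ →
      ∀ t, M₁ t *ᵥ (Y t *ᵥ y₀) = Y t *ᵥ y₀) ∧
    (∀ y₀ : Fin m → ℝ, M₁ 0 *ᵥ y₀ = 0 →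
      ∀ t, M₁ t *ᵥ (Y t *ᵥ y₀) = 0) ∧
    (∀ t : ℝ, P t = (Φ₁' t + Φ₁ t * Q t) * Φ₁p t) ∧
    (∀ t : ℝ, G t = (Φ₂' t + Φ₂ t * Q t) * Φ₂p t) := by
  have e1 : ∀ t, Φ₁ t * Y t = X t * Φ₁ 0 := fun t => by
    rw [hred, Matrix.mul_add]
    simp only [← Matrix.mul_assoc, hid1, hid3, Matrix.one_mul, Matrix.zero_mul, add_zero]
  have e2 : ∀ t, Φ₂ t * Y t = Z t * Φ₂ 0 := fun t => by
    rw [hred, Matrix.mul_add]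
    simp only [← Matrix.mul_assoc, hid2, hid4, Matrix.one_mul, Matrix.zero_mul, zero_add]
  refine ⟨fun y hy t => ?_, fun y hy t => ?_,
    block_formula Φ₁ Φ₁' Φ₁p Q Y P X hΦ₁ hid1 hQ hY hY0 hX e1,
    block_formula Φ₂ Φ₂' Φ₂p Q Y G Z hΦ₂ hid2 hQ hY hY0 hZ e2⟩
  · have hz : Φ₂ 0 *ᵥ y = 0 := by
      rw [← hy, hM₁, Matrix.mulVec_mulVec, ← Matrix.mul_assoc, hid4, Matrix.zero_mul,
        Matrix.zero_mulVec]
    have hm : M₁ t = 1 - Φ₂p t * Φ₂ t := by rw [hM₁, ← hid5 t, add_sub_cancel_right]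
    rw [hm, Matrix.sub_mulVec, Matrix.one_mulVec, Matrix.mulVec_mulVec, Matrix.mul_assoc, e2,
      ← Matrix.mul_assoc, ← Matrix.mulVec_mulVec, hz, Matrix.mulVec_zero, sub_zero]
  · have hz : Φ₁ 0 *ᵥ y = 0 := by
      have := congrArg (fun w => Φ₁ 0 *ᵥ w) hy
      simpa only [hM₁, Matrix.mulVec_mulVec, ← Matrix.mul_assoc, hid1, Matrix.one_mul,
        Matrix.mulVec_zero] using this
    rw [hM₁, Matrix.mulVec_mulVec, Matrix.mul_assoc, e1,
      ← Matrix.mul_assoc, ← Matrix.mulVec_mulVec, hz, Matrix.mulVec_zero]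
end

section
/- Let X : ℝ → M_n(ℝ) and Z : ℝ → M_p(ℝ) be matrix functions such that Y(t)Φ₁⁺(0) = Φ₁⁺(t)X(t), Y(t)Φ₂⁺(0) = Φ₂⁺(t)Z(t), and X(t)F⁺(0) = F⁺(t)Z(t) for all t ∈ ℝ. Then the fundamental matrices of the equivalent equations are expressed through one another: Y(t) = Φ₁⁺(t)X(t)Φ₁(0) + Φ₂⁺(t)F(t)X(t)F⁺(0)Φ₂(0) and X(t) = Φ₁(t)Y(t)Φ₁⁺(0) for all t ∈ ℝ. -/
open Matrix

/-- The fundamental matrices of solutions of equivalent differential equations are expressed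
in terms of one another:
`Y(t) = Φ₁⁺(t)X(t)Φ₁(0) + Φ₂⁺(t)F(t)X(t)F⁺(0)Φ₂(0)` and `X(t) = Φ₁(t)Y(t)Φ₁⁺(0)`. -/
theorem fundamental_matrices_of_equivalent_equations
    (m n : ℕ) (hn : 0 < n) (hnm : n < m)
    (Φ₁ : ℝ → Matrix (Fin n) (Fin m) ℝ) (Φ₂ : ℝ → Matrix (Fin (m - n)) (Fin m) ℝ)
    (Φ₁p : ℝ → Matrix (Fin m) (Fin n) ℝ) (Φ₂p : ℝ → Matrix (Fin m) (Fin (m - n)) ℝ)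
    (Φ₁' : ℝ → Matrix (Fin n) (Fin m) ℝ) (Φ₂' : ℝ → Matrix (Fin (m - n)) (Fin m) ℝ)
    (Φ₁p' : ℝ → Matrix (Fin m) (Fin n) ℝ) (Φ₂p' : ℝ → Matrix (Fin m) (Fin (m - n)) ℝ)
    (hΦ₁ : ∀ t, MHasDerivAt Φ₁ (Φ₁' t) t) (hΦ₁c : Continuous Φ₁')
    (hΦ₂ : ∀ t, MHasDerivAt Φ₂ (Φ₂' t) t) (hΦ₂c : Continuous Φ₂')
    (hΦ₁p : ∀ t, MHasDerivAt Φ₁p (Φ₁p' t) t) (hΦ₁pc : Continuous Φ₁p')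
    (hΦ₂p : ∀ t, MHasDerivAt Φ₂p (Φ₂p' t) t) (hΦ₂pc : Continuous Φ₂p')
    -- block relations coming from `Φ(t)⁻¹ Φ(t) = Φ(t) Φ(t)⁻¹ = E`
    (hid1 : ∀ t, Φ₁ t * Φ₁p t = 1)
    (hid2 : ∀ t, Φ₂ t * Φ₂p t = 1)
    (hid3 : ∀ t, Φ₁ t * Φ₂p t = 0)
    (hid4 : ∀ t, Φ₂ t * Φ₁p t = 0)
    (hid5 : ∀ t, Φ₁p t * Φ₁ t + Φ₂p t * Φ₂ t = 1)
    (Q : ℝ → Matrix (Fin m) (Fin m) ℝ) (hQ : Continuous Q)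
    (Y : ℝ → Matrix (Fin m) (Fin m) ℝ)
    (hY : ∀ t, MHasDerivAt Y (Q t * Y t) t) (hY0 : Y 0 = 1)
    (F : ℝ → Matrix (Fin (m - n)) (Fin n) ℝ) (Fp : ℝ → Matrix (Fin n) (Fin (m - n)) ℝ)
    (F' : ℝ → Matrix (Fin (m - n)) (Fin n) ℝ) (Fp' : ℝ → Matrix (Fin n) (Fin (m - n)) ℝ)
    (hF : ∀ t, MHasDerivAt F (F' t) t) (hFc : Continuous F')
    (hFp : ∀ t, MHasDerivAt Fp (Fp' t) t) (hFpc : Continuous Fp')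
    (hFFp : ∀ t, F t * Fp t = 1)
    (X : ℝ → Matrix (Fin n) (Fin n) ℝ) (Z : ℝ → Matrix (Fin (m - n)) (Fin (m - n)) ℝ)
    (h1 : ∀ t, Y t * Φ₁p 0 = Φ₁p t * X t)
    (h2 : ∀ t, Y t * Φ₂p 0 = Φ₂p t * Z t)
    (h3 : ∀ t, X t * Fp 0 = Fp t * Z t) :
    (∀ t : ℝ, Y t = Φ₁p t * X t * Φ₁ 0 + Φ₂p t * (F t * X t * Fp 0) * Φ₂ 0) ∧
    (∀ t : ℝ, X t = Φ₁ t * Y t * Φ₁p 0) := by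
  refine ⟨fun t => ?_, fun t => ?_⟩
  · have hZ : F t * X t * Fp 0 = Z t := by
      rw [Matrix.mul_assoc, h3, ← Matrix.mul_assoc, hFFp, Matrix.one_mul]
    rw [hZ, ← h1, ← h2, Matrix.mul_assoc, Matrix.mul_assoc, ← Matrix.mul_add, hid5,
      Matrix.mul_one]
  · rw [Matrix.mul_assoc, h1, ← Matrix.mul_assoc, hid1, Matrix.one_mul]
end

section
/- Let P : ℝ → M_n(ℝ) be continuous, let 𝒳 : ℝ × ℝⁿ → ℝⁿ be continuous, let H ∈ M_m(ℝ), let Φ : ℝ → M_{n×m}(ℝ) be continuously differentiable with Φ′(t) + Φ(t)H = P(t)Φ(t) for all t, and let Φ⁺ : ℝ → M_{m×n}(ℝ) satisfy Φ(t)Φ⁺(t) = Eₙ for all t. If y : ℝ → ℝ^m is differentiable and solves y′ = Hy + Φ⁺(t)·𝒳(t, Φ(t)y), then x(t) := Φ(t)y(t) is differentiable and solves the original equation x′ = P(t)x + 𝒳(t, x). -/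
open Matrix

/-- If `Φ' + ΦH = P(t)Φ`, `ΦΦ⁺ = Eₙ`, and `y` solves the transformed equation
`y' = Hy + Φ⁺(t)·𝒳(t, Φ(t)y)`, then `x(t) = Φ(t)y(t)` solves the original equation
`x' = P(t)x + 𝒳(t, x)`. -/
theorem transformed_solution_gives_original_solution
    (n m : ℕ)
    (P : ℝ → Matrix (Fin n) (Fin n) ℝ) (hPc : Continuous P)
    (𝒳 : ℝ → (Fin n → ℝ) → (Fin n → ℝ))
    (h𝒳c : Continuous fun p : ℝ × (Fin n → ℝ) => 𝒳 p.1 p.2)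
    (H : Matrix (Fin m) (Fin m) ℝ)
    (Φ : ℝ → Matrix (Fin n) (Fin m) ℝ)
    (hΦ : ∀ t, MHasDerivAt Φ (P t * Φ t - Φ t * H) t)
    (hΦc : Continuous fun t => P t * Φ t - Φ t * H)
    (Φp : ℝ → Matrix (Fin m) (Fin n) ℝ)
    (hΦp : ∀ t : ℝ, Φ t * Φp t = 1)
    (y : ℝ → Fin m → ℝ)
    (hy : ∀ t : ℝ, HasDerivAt y (H *ᵥ y t + Φp t *ᵥ 𝒳 t (Φ t *ᵥ y t)) t) :
    ∀ t : ℝ, HasDerivAt (fun s => Φ s *ᵥ y s)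
      (P t *ᵥ (Φ t *ᵥ y t) + 𝒳 t (Φ t *ᵥ y t)) t := by
  intro t
  rw [hasDerivAt_pi]
  intro i
  have hy' := fun j => (hasDerivAt_pi.mp (hy t)) j
  have key : HasDerivAt (fun s => ∑ j, Φ s i j * y s j)
      (∑ j, ((P t * Φ t - Φ t * H) i j * y t j +
        Φ t i j * (H *ᵥ y t + Φp t *ᵥ 𝒳 t (Φ t *ᵥ y t)) j)) t :=
    HasDerivAt.fun_sum fun j _ => (hΦ t i j).mul (hy' j)
  have e : (P t *ᵥ (Φ t *ᵥ y t) + 𝒳 t (Φ t *ᵥ y t)) =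
      (P t * Φ t - Φ t * H) *ᵥ y t + Φ t *ᵥ (H *ᵥ y t + Φp t *ᵥ 𝒳 t (Φ t *ᵥ y t)) := by
    rw [Matrix.mulVec_add, Matrix.mulVec_mulVec _ (Φ t) (Φp t), hΦp, Matrix.one_mulVec,
      Matrix.sub_mulVec, Matrix.mulVec_mulVec, Matrix.mulVec_mulVec]
    abel
  rw [e]
  rw [Finset.sum_add_distrib] at key
  exact key
end
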